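/- Let m, n ≥ 2 and let A be an m×n complex matrix that is not constant (equivalently, σ₂(A) > 0). Then E(A) ≥ σ₁(A) + (tr(AA*) − σ₁(A)²)/σ₂(A). -/

import Mathlib

open Matrix

/-- The singular values of a complex `m × n` matrix `A`, listed in decreasing order:
`singularValues A i` is the `i`-th largest square root of an eigenvalue of `A * Aᴴ`. -/
noncomputable def singularValues {m n : ℕ} (A : Matrix (Fin m) (Fin n) ℂ) : Fin m → ℝ :=
  fun i =>
    Real.sqrt ((Matrix.isHermitian_mul_conjTranspose_self A).eigenvalues
      (Tuple.sort (Matrix.isHermitian_mul_conjTranspose_self A).eigenvalues i.rev))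

/-- The energy of a matrix: the sum of its singular values. -/
noncomputable def energy {m n : ℕ} (A : Matrix (Fin m) (Fin n) ℂ) : ℝ :=
  ∑ i, singularValues A i

theorem singularValues_nonneg {m n : ℕ} (A : Matrix (Fin m) (Fin n) ℂ) (i : Fin m) :
    0 ≤ singularValues A i :=
  Real.sqrt_nonneg _

theorem singularValues_antitone {m n : ℕ} (A : Matrix (Fin m) (Fin n) ℂ) :
    Antitone (singularValues A) := fun _ _ hij =>
  Real.sqrt_le_sqrt (Tuple.monotone_sort
    (isHermitian_mul_conjTranspose_self A).eigenvalues (Fin.rev_le_rev.mpr hij))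

open scoped ComplexOrder in
theorem sum_sq_singularValues {m n : ℕ} (A : Matrix (Fin m) (Fin n) ℂ) :
    ∑ i, singularValues A i ^ 2 = (A * Aᴴ).trace.re := by
  set hA := isHermitian_mul_conjTranspose_self A
  have hsq (i : Fin m) :
      singularValues A i ^ 2 = hA.eigenvalues ((Fin.revPerm.trans (Tuple.sort hA.eigenvalues)) i) :=
    Real.sq_sqrt ((posSemidef_self_mul_conjTranspose A).eigenvalues_nonneg _)
  rw [Fintype.sum_congr _ _ hsq, Equiv.sum_comp _ hA.eigenvalues, hA.trace_eq_sum_eigenvalues]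
  simp

/-- If `m, n ≥ 2` and `A` is an `m × n` complex matrix which is
nonconstant (equivalently, `σ₂(A) > 0`), then
`E(A) ≥ σ₁(A) + (tr(AA*) - σ₁(A)²)/σ₂(A)`. -/
theorem energy_lower_bound {m n : ℕ} (hm : 2 ≤ m) (hn : 2 ≤ n)
    (A : Matrix (Fin m) (Fin n) ℂ)
    (hσ₂ : 0 < singularValues A ⟨1, by omega⟩) :
    singularValues A ⟨0, by omega⟩ +
        ((Matrix.trace (A * Aᴴ)).re - (singularValues A ⟨0, by omega⟩) ^ 2) /
          singularValues A ⟨1, by omega⟩ ≤ energy A := by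
  obtain ⟨k, rfl⟩ := Nat.exists_eq_add_of_le' hm
  rw [← sum_sq_singularValues, energy, Fin.sum_univ_succ, Fin.sum_univ_succ (singularValues A)]
  change singularValues A 0 + (singularValues A 0 ^ 2 + _ - singularValues A 0 ^ 2) / _ ≤ _
  rw [add_sub_cancel_left]
  gcongr
  rw [div_le_iff₀ hσ₂, Finset.sum_mul]
  gcongr with i
  rw [sq]
  exact mul_le_mul_of_nonneg_left
    (singularValues_antitone A (Fin.mk_le_mk.mpr (Nat.le_add_left 1 i)))
    (singularValues_nonneg A _)
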